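/- arXiv:1504.06652 — 2 statements merged into one kernel-verified Lean document; each statement's English description precedes it below -/
import Mathlib

section
/- For every squarefree integer d ≥ 2, the three real numbers 1, 2·cos(π/16), and 2·cos(7π/16) are linearly independent over the real quadratic field ℚ(√d). In particular, the minimal polynomial of both 2·cos(π/16) and 2·cos(7π/16) over ℚ(√2) is z^4 - 4z^2 + 2 - √2. -/
open Polynomial

/-- Elements of a field generated over `ℚ` by a square root of a rational number. -/
theorem exists_rat_add_rat_mul_of_mem_adjoin {r : ℝ} {n : ℚ} (hr : r ^ 2 = n) {z : ℝ}
    (hz : z ∈ IntermediateField.adjoin ℚ {r}) : ∃ p q : ℚ, z = p + q * r := by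
  induction hz using IntermediateField.adjoin_induction with
  | mem x hx => exact ⟨0, 1, by simpa using hx⟩
  | algebraMap x => exact ⟨x, 0, by simp⟩
  | add x y _ _ hx hy =>
    obtain ⟨p, q, rfl⟩ := hx
    obtain ⟨p', q', rfl⟩ := hy
    exact ⟨p + p', q + q', by push_cast; ring⟩
  | mul x y _ _ hx hy =>
    obtain ⟨p, q, rfl⟩ := hx
    obtain ⟨p', q', rfl⟩ := hy
    refine ⟨p * p' + q * q' * n, p * q' + q * p', ?_⟩
    push_cast
    linear_combination (q * q' : ℝ) * hr
  | inv x _ hx =>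
    obtain ⟨p, q, rfl⟩ := hx
    by_cases h : (p : ℝ) - q * r = 0
    · refine ⟨(2 * p)⁻¹, 0, ?_⟩
      have h' : (p : ℝ) + q * r = 2 * p := by linear_combination -h
      rw [h']
      push_cast
      ring
    · by_cases h' : (p : ℝ) + q * r = 0
      · exact ⟨0, 0, by simp [h']⟩
      · refine ⟨p / (p ^ 2 - q ^ 2 * n), -q / (p ^ 2 - q ^ 2 * n), ?_⟩
        have hN : (p : ℝ) ^ 2 - q ^ 2 * n = (p - q * r) * (p + q * r) := by
          linear_combination (q : ℝ) ^ 2 * hr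
        push_cast
        rw [hN]
        field_simp
        ring

theorem rat_sq_ne_two (q : ℚ) : q ^ 2 ≠ 2 := fun h =>
  irrational_sqrt_two ⟨|q|, by
    have h' : (q : ℝ) ^ 2 = 2 := by exact_mod_cast h
    rw [← h', Real.sqrt_sq_eq_abs, Rat.cast_abs]⟩

/-- A square root of `2 + √2` does not lie in `ℚ(√2)`. -/
theorem sq_ne_two_add_of_rat {s : ℝ} (hs : s ^ 2 = 2) (g h : ℚ) :
    ((g : ℝ) + h * s) ^ 2 ≠ 2 + s := by
  intro H
  have key : ((2 * g * h - 1 : ℚ) : ℝ) * s = ((2 - g ^ 2 - 2 * h ^ 2 : ℚ) : ℝ) := by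
    push_cast
    linear_combination H - (h : ℝ) ^ 2 * hs
  have hgh : 2 * g * h - 1 = 0 := by
    by_contra hne
    apply rat_sq_ne_two ((2 - g ^ 2 - 2 * h ^ 2) / (2 * g * h - 1))
    have hs' : s = (((2 - g ^ 2 - 2 * h ^ 2) / (2 * g * h - 1) : ℚ) : ℝ) := by
      rw [Rat.cast_div, ← key]
      have : ((2 * g * h - 1 : ℚ) : ℝ) ≠ 0 := by exact_mod_cast hne
      field_simp
    rw [hs'] at hs
    exact_mod_cast hs
  rw [hgh, Rat.cast_zero, zero_mul] at key
  have key' : 2 - g ^ 2 - 2 * h ^ 2 = 0 := by exact_mod_cast key.symm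
  apply rat_sq_ne_two (g ^ 2 - 2 * h ^ 2)
  linear_combination (-(2 + g ^ 2 + 2 * h ^ 2)) * key' - 2 * (2 * g * h + 1) * hgh

/-- A square root of `2 + √2` does not lie in any field `ℚ(√n)`. -/
theorem notMem_adjoin_of_sq_eq_two_add {r s t : ℝ} {n : ℚ} (hr : r ^ 2 = n) (hs : s ^ 2 = 2)
    (ht : t ^ 2 = 2 + s) : t ∉ IntermediateField.adjoin ℚ {r} := by
  intro hmem
  obtain ⟨p, q, hpq⟩ := exists_rat_add_rat_mul_of_mem_adjoin hr hmem
  have hlin : s = 2 * p * t + (q ^ 2 * n - p ^ 2 - 2) := by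
    have : (t - p) ^ 2 = q ^ 2 * n := by rw [hpq, ← hr]; ring
    linear_combination this - ht
  by_cases hp : p = 0
  · apply rat_sq_ne_two (q ^ 2 * n - 2)
    have : s = q ^ 2 * n - 2 := by rw [hlin, hp]; simp
    rw [this] at hs
    exact_mod_cast hs
  · have hp' : (p : ℝ) ≠ 0 := by exact_mod_cast hp
    apply sq_ne_two_add_of_rat hs (-(q ^ 2 * n - p ^ 2 - 2) / (2 * p)) (1 / (2 * p))
    rw [← ht]
    congr 1
    push_cast
    field_simp
    linear_combination hlin

section

variable {K : IntermediateField ℚ ℝ} {s t : ℝ}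

/-- If `√(2 + √2) ∉ K` then `2 - √2` is not a square in `K`. -/
theorem eq_zero_of_sq_eq_sq_mul_two_sub (hs : s ^ 2 = 2) (ht : t ^ 2 = 2 + s) (hsK : s ∈ K)
    (htK : t ∉ K) {q N : ℝ} (hq : q ∈ K) (hN : N ∈ K) (h : q ^ 2 = N ^ 2 * (2 - s)) :
    N = 0 := by
  by_contra hN0
  have hs1 : s - 1 ≠ 0 := fun h1 => by
    have : s = 1 := by linear_combination h1
    norm_num [this] at hs
  have hsq : (N * (s - 1) * t) ^ 2 = q ^ 2 := by
    rw [h, mul_pow, ht]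
    linear_combination N ^ 2 * s * hs
  apply htK
  have hD : N * (s - 1) ∈ K := mul_mem hN (sub_mem hsK (one_mem K))
  have hmem : N * (s - 1) * t ∈ K := by
    rcases sq_eq_sq_iff_eq_or_eq_neg.mp hsq with h | h <;> rw [h]
    exacts [hq, neg_mem hq]
  have := mul_mem (inv_mem hD) hmem
  rwa [inv_mul_cancel_left₀ (mul_ne_zero hN0 hs1)] at this

theorem eq_zero_of_add_mul_eq_zero (htK : t ∉ K) {a b : ℝ} (ha : a ∈ K) (hb : b ∈ K)
    (h : a + b * t = 0) : a = 0 ∧ b = 0 := by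
  have hb0 : b = 0 := by
    by_contra hb0
    apply htK
    have : t = -a / b := by field_simp; linear_combination h
    rw [this]
    exact div_mem (neg_mem ha) hb
  subst hb0
  exact ⟨by simpa using h, rfl⟩

theorem eq_zero_of_add_mul_add_mul_eq_zero (hs : s ^ 2 = 2) (ht : t ^ 2 = 2 + s) (htK : t ∉ K)
    {x y : ℝ} (hx : x ^ 2 = 2 + t) (hy : y ^ 2 = 2 - t) (hxy : x * y = t * (s - 1))
    {a b c : ℝ} (ha : a ∈ K) (hb : b ∈ K) (hc : c ∈ K) (h : a + b * x + c * y = 0) :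
    a = 0 ∧ b = 0 ∧ c = 0 := by
  have h2 : (2 : ℝ) ∈ K := ofNat_mem K 2
  have hA : 2 * (b ^ 2 + c ^ 2) - a ^ 2 ∈ K :=
    sub_mem (mul_mem h2 (add_mem (pow_mem hb 2) (pow_mem hc 2))) (pow_mem ha 2)
  have hB : b ^ 2 - c ^ 2 ∈ K := sub_mem (pow_mem hb 2) (pow_mem hc 2)
  have hC : 2 * b * c ∈ K := mul_mem (mul_mem h2 hb) hc
  have hsum : 2 * (b ^ 2 + c ^ 2) - a ^ 2 + (b ^ 2 - c ^ 2 + 2 * b * c * (s - 1)) * t = 0 := by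
    linear_combination (b * x + c * y - a) * h - b ^ 2 * hx - c ^ 2 * hy - 2 * b * c * hxy
  suffices b = 0 ∧ c = 0 by
    obtain ⟨rfl, rfl⟩ := this
    exact ⟨by simpa using h, rfl, rfl⟩
  by_cases hsK : s ∈ K
  · have hs1 := sub_mem hsK (one_mem K)
    have hBC := (eq_zero_of_add_mul_eq_zero htK hA (add_mem hB (mul_mem hC hs1)) hsum).2
    have hs0 : s ≠ 0 := by rintro rfl; norm_num at hs
    have hc0 : s * c = 0 := eq_zero_of_sq_eq_sq_mul_two_sub hs ht hsK htK
      (add_mem hb (mul_mem hc hs1)) (mul_mem hsK hc)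
      (by linear_combination hBC + c ^ 2 * (s - 1) * hs)
    obtain rfl : c = 0 := (mul_eq_zero.mp hc0).resolve_left hs0
    exact ⟨by simpa using hBC, rfl⟩
  · generalize hAd : 2 * (b ^ 2 + c ^ 2) - a ^ 2 = A at hA hsum
    generalize hBd : b ^ 2 - c ^ 2 = B at hB hsum
    generalize hCd : 2 * b * c = C at hC hsum
    have hlin : 2 * (B ^ 2 + C ^ 2) - A ^ 2 + (B ^ 2 - C ^ 2 + 2 * B * C) * s = 0 := by
      linear_combination ((B + C * (s - 1)) * t - A) * hsum
        - (B + C * (s - 1)) ^ 2 * ht - (2 * B * C + C ^ 2 * s) * hs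
    have hq := (eq_zero_of_add_mul_eq_zero hsK
      (sub_mem (mul_mem h2 (add_mem (pow_mem hB 2) (pow_mem hC 2))) (pow_mem hA 2))
      (add_mem (sub_mem (pow_mem hB 2) (pow_mem hC 2)) (mul_mem (mul_mem h2 hB) hC)) hlin).2
    have hBC : B = 0 ∧ C = 0 := by
      have hfac : (B + C + C * s) * (B + C + (-C) * s) = 0 := by
        linear_combination hq - C ^ 2 * hs
      rcases mul_eq_zero.mp hfac with h | h
      · obtain ⟨h₁, h₂⟩ := eq_zero_of_add_mul_eq_zero hsK (add_mem hB hC) hC h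
        exact ⟨by linarith, h₂⟩
      · obtain ⟨h₁, h₂⟩ := eq_zero_of_add_mul_eq_zero hsK (add_mem hB hC) (neg_mem hC) h
        exact ⟨by linarith, by linarith⟩
    obtain ⟨rfl, rfl⟩ := hBC
    have hb0 : b = 0 := by
      rw [← pow_eq_zero_iff (n := 4) (by norm_num)]
      linear_combination b ^ 2 * hBd + b * c / 2 * hCd
    subst hb0
    exact ⟨rfl, by simpa using hBd⟩

theorem coeffs_eq_zero_of_cubic_eq_zero (hs : s ^ 2 = 2) (ht : t ^ 2 = 2 + s) (hsK : s ∈ K)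
    (htK : t ∉ K) {x : ℝ} (hx : x ^ 2 = 2 + t) {a b c d : ℝ} (ha : a ∈ K) (hb : b ∈ K)
    (hc : c ∈ K) (hd : d ∈ K) (h : a + b * x + c * x ^ 2 + d * x ^ 3 = 0) :
    a = 0 ∧ b = 0 ∧ c = 0 ∧ d = 0 := by
  have h2 : (2 : ℝ) ∈ K := ofNat_mem K 2
  have hg : a + 2 * c ∈ K := add_mem ha (mul_mem h2 hc)
  have he : b + 2 * d ∈ K := add_mem hb (mul_mem h2 hd)
  have hlin : (a + 2 * c + c * t) + (b + 2 * d + d * t) * x = 0 := by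
    linear_combination h - (c + d * x) * hx
  generalize hgd : a + 2 * c = g at hg hlin
  generalize hed : b + 2 * d = e at he hlin
  have hw : 2 + s ∈ K := add_mem h2 hsK
  have hq : g ^ 2 - c ^ 2 * (2 + s) ∈ K :=
    sub_mem (pow_mem hg 2) (mul_mem (pow_mem hc 2) hw)
  have hN : e ^ 2 - d ^ 2 * (2 + s) ∈ K :=
    sub_mem (pow_mem he 2) (mul_mem (pow_mem hd 2) hw)
  have hsq : (g ^ 2 + c ^ 2 * (2 + s) - 2 * (e ^ 2 + d ^ 2 * (2 + s)) - 2 * e * d * (2 + s))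
      + (2 * g * c - (e ^ 2 + d ^ 2 * (2 + s)) - 4 * e * d) * t = 0 := by
    linear_combination (g + c * t - (e + d * t) * x) * hlin + (e + d * t) ^ 2 * hx
      - (c ^ 2 - 2 * d ^ 2 - 2 * e * d - d ^ 2 * t) * ht
  obtain ⟨h₁, h₂⟩ := eq_zero_of_add_mul_eq_zero htK
    (by
      refine sub_mem (sub_mem (add_mem (pow_mem hg 2) (mul_mem (pow_mem hc 2) hw)) ?_) ?_
      · exact mul_mem h2 (add_mem (pow_mem he 2) (mul_mem (pow_mem hd 2) hw))
      · exact mul_mem (mul_mem (mul_mem h2 he) hd) hw)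
    (by
      refine sub_mem (sub_mem (mul_mem (mul_mem h2 hg) hc) ?_) ?_
      · exact add_mem (pow_mem he 2) (mul_mem (pow_mem hd 2) hw)
      · exact mul_mem (mul_mem (ofNat_mem K 4) he) hd) hsq
  have hN0 := eq_zero_of_sq_eq_sq_mul_two_sub hs ht hsK htK hq hN (by
    linear_combination (g ^ 2 + c ^ 2 * (2 + s) + 2 * (e ^ 2 + d ^ 2 * (2 + s))
        + 2 * e * d * (2 + s)) * h₁
      - (2 + s) * (2 * g * c + (e ^ 2 + d ^ 2 * (2 + s)) + 4 * e * d) * h₂)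
  have hfac : (e + d * t) * (e + (-d) * t) = 0 := by linear_combination hN0 - d ^ 2 * ht
  have hed0 : e = 0 ∧ d = 0 := by
    rcases mul_eq_zero.mp hfac with h | h
    · exact eq_zero_of_add_mul_eq_zero htK he hd h
    · obtain ⟨h₁, h₂⟩ := eq_zero_of_add_mul_eq_zero htK he (neg_mem hd) h
      exact ⟨h₁, neg_eq_zero.mp h₂⟩
  obtain ⟨rfl, rfl⟩ := hed0
  obtain ⟨rfl, rfl⟩ := eq_zero_of_add_mul_eq_zero htK hg hc (by simpa using hlin)
  exact ⟨by simpa using hgd, by simpa using hed, rfl, rfl⟩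

theorem minpoly_map_of_sq_eq_two_add (hs : s ^ 2 = 2) (ht : t ^ 2 = 2 + s) (hsK : s ∈ K)
    (htK : t ∉ K) {x : ℝ} (hx : x ^ 2 = 2 + t) :
    (minpoly K x).map (algebraMap K ℝ) = X ^ 4 - 4 * X ^ 2 + C (2 - s) := by
  let w : K := 2 - ⟨s, hsK⟩
  have hw : algebraMap K ℝ w = 2 - s := rfl
  have hdeg : (X ^ 4 - C 4 * X ^ 2 + C w : K[X]).degree = 4 := by compute_degree!
  have hmin : X ^ 4 - C 4 * X ^ 2 + C w = minpoly K x := by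
    refine minpoly.unique' K x (by monicity!) ?_ ?_
    · simp only [map_add, map_sub, map_mul, map_pow, aeval_X, aeval_C, hw, map_ofNat]
      linear_combination (x ^ 2 - 2 + t) * hx + ht
    · intro q hq
      rw [hdeg] at hq
      rw [or_iff_not_imp_right, not_not]
      intro h0
      have hnat : q.natDegree < 4 := by
        by_cases hq0 : q = 0
        · simp [hq0]
        · exact (natDegree_lt_iff_degree_lt hq0).mpr hq
      rw [aeval_eq_sum_range' hnat] at h0
      simp only [Finset.sum_range_succ, Finset.sum_range_zero, zero_add, pow_zero, pow_one,
        Algebra.smul_def, mul_one] at h0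
      obtain ⟨h₀, h₁, h₂, h₃⟩ := coeffs_eq_zero_of_cubic_eq_zero hs ht hsK htK hx
        (q.coeff 0).2 (q.coeff 1).2 (q.coeff 2).2 (q.coeff 3).2 h0
      refine Polynomial.ext fun n => ?_
      by_cases hn : n < 4
      · interval_cases n
        exacts [ZeroMemClass.coe_eq_zero.mp h₀, ZeroMemClass.coe_eq_zero.mp h₁,
          ZeroMemClass.coe_eq_zero.mp h₂, ZeroMemClass.coe_eq_zero.mp h₃]
      · rw [coeff_eq_zero_of_natDegree_lt (by omega), coeff_zero]
  rw [← hmin]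
  simp only [Polynomial.map_add, Polynomial.map_sub, Polynomial.map_mul, Polynomial.map_pow, map_X,
    map_C, hw, map_ofNat, Polynomial.map_ofNat]

end

theorem cos_sixteenth_independent_over_all_real_quadratic :
    (∀ d : ℤ, 2 ≤ d → Squarefree d →
      ∀ a b c : ℝ,
        a ∈ IntermediateField.adjoin ℚ {Real.sqrt (d : ℝ)} →
        b ∈ IntermediateField.adjoin ℚ {Real.sqrt (d : ℝ)} →
        c ∈ IntermediateField.adjoin ℚ {Real.sqrt (d : ℝ)} →
        a * 1 + b * (2 * Real.cos (Real.pi / 16)) + c * (2 * Real.cos (7 * Real.pi / 16)) = 0 →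
        a = 0 ∧ b = 0 ∧ c = 0) ∧
    (minpoly (IntermediateField.adjoin ℚ {Real.sqrt 2}) (2 * Real.cos (Real.pi / 16))).map
        (algebraMap (IntermediateField.adjoin ℚ {Real.sqrt 2}) ℝ) =
      X ^ 4 - 4 * X ^ 2 + C (2 - Real.sqrt 2) ∧
    (minpoly (IntermediateField.adjoin ℚ {Real.sqrt 2}) (2 * Real.cos (7 * Real.pi / 16))).map
        (algebraMap (IntermediateField.adjoin ℚ {Real.sqrt 2}) ℝ) =
      X ^ 4 - 4 * X ^ 2 + C (2 - Real.sqrt 2) := by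
  have hs : Real.sqrt 2 ^ 2 = 2 := Real.sq_sqrt (by norm_num)
  have ht : (2 * Real.cos (Real.pi / 8)) ^ 2 = 2 + Real.sqrt 2 := by
    have h := Real.cos_two_mul (Real.pi / 8)
    rw [show 2 * (Real.pi / 8) = Real.pi / 4 by ring, Real.cos_pi_div_four] at h
    linear_combination -2 * h
  have hcos := Real.cos_two_mul (Real.pi / 16)
  have hsin := Real.sin_two_mul (Real.pi / 16)
  have hsin' := Real.sin_two_mul (Real.pi / 8)
  rw [show 2 * (Real.pi / 16) = Real.pi / 8 by ring] at hcos hsin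
  rw [show 2 * (Real.pi / 8) = Real.pi / 4 by ring, Real.sin_pi_div_four] at hsin'
  have hcompl : Real.cos (7 * Real.pi / 16) = Real.sin (Real.pi / 16) := by
    rw [← Real.cos_pi_div_two_sub]
    congr 1
    ring
  have hx : (2 * Real.cos (Real.pi / 16)) ^ 2 = 2 + 2 * Real.cos (Real.pi / 8) := by
    linear_combination -2 * hcos
  have hy : (2 * Real.cos (7 * Real.pi / 16)) ^ 2 = 2 - 2 * Real.cos (Real.pi / 8) := by
    rw [hcompl]
    linear_combination 4 * Real.sin_sq_add_cos_sq (Real.pi / 16) + 2 * hcos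
  have hxy : 2 * Real.cos (Real.pi / 16) * (2 * Real.cos (7 * Real.pi / 16)) =
      2 * Real.cos (Real.pi / 8) * (Real.sqrt 2 - 1) := by
    have hc : 2 * Real.cos (Real.pi / 8) ≠ 0 := by
      intro h0
      rw [h0] at ht
      nlinarith [Real.sqrt_nonneg 2]
    rw [hcompl]
    apply mul_left_cancel₀ hc
    linear_combination (-4 * Real.cos (Real.pi / 8)) * hsin - 2 * hsin'
      - (Real.sqrt 2 - 1) * ht - hs
  have hmem : Real.sqrt 2 ∈ IntermediateField.adjoin ℚ {Real.sqrt 2} :=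
    IntermediateField.mem_adjoin_simple_self ℚ _
  have hnotMem : 2 * Real.cos (Real.pi / 8) ∉ IntermediateField.adjoin ℚ {Real.sqrt 2} :=
    notMem_adjoin_of_sq_eq_two_add (n := 2) (by simp) hs ht
  refine ⟨?_, minpoly_map_of_sq_eq_two_add hs ht hmem hnotMem hx, ?_⟩
  · intro d hd _ a b c ha hb hc h
    have hd0 : (0 : ℝ) ≤ d := by exact_mod_cast (by norm_num : (0 : ℤ) ≤ 2).trans hd
    exact eq_zero_of_add_mul_add_mul_eq_zero hs ht
      (notMem_adjoin_of_sq_eq_two_add (n := d) (by rw [Real.sq_sqrt hd0]; simp) hs ht)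
      hx hy hxy ha hb hc (by rwa [mul_one] at h)
  · refine minpoly_map_of_sq_eq_two_add hs (t := -(2 * Real.cos (Real.pi / 8)))
      (by rw [neg_sq, ht]) hmem (fun h => hnotMem (by simpa using neg_mem h)) ?_
    rw [hy, sub_eq_add_neg]
end

section
/- Let r1, r2 be rational numbers with N(r1) = N(r2) = 5 such that neither r1 - r2 nor r1 + r2 is an integer. Then the ratio sin(π·r1)/sin(π·r2) lies in the real quadratic field ℚ(√5); in particular, sin(2π/5)/sin(π/5) = (1 + √5)/2. -/
/-- If a subfield of `ℝ` contains `cos x`, then it contains `cos (n * x)` and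
`sin (n * x) / sin x` for every natural number `n`. -/
theorem cos_nat_mul_mem_and_sin_nat_mul_div_sin_mem {F : Type*} [Field F] [Algebra F ℝ]
    (K : IntermediateField F ℝ) {x : ℝ} (hsin : Real.sin x ≠ 0) (hcos : Real.cos x ∈ K) (n : ℕ) :
    Real.cos (n * x) ∈ K ∧ Real.sin (n * x) / Real.sin x ∈ K := by
  induction n with
  | zero => simp [K.one_mem, K.zero_mem]
  | succ n ih =>
    obtain ⟨hc, hs⟩ := ih
    have hsq : Real.sin x ^ 2 ∈ K := by
      rw [Real.sin_sq]
      exact K.sub_mem K.one_mem (K.pow_mem hcos 2)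
    have cos_succ : Real.cos ((n + 1 : ℕ) * x) =
        Real.cos (n * x) * Real.cos x - Real.sin (n * x) / Real.sin x * Real.sin x ^ 2 := by
      rw [Nat.cast_succ, add_one_mul, Real.cos_add]
      field_simp
    have sin_succ : Real.sin ((n + 1 : ℕ) * x) / Real.sin x =
        Real.sin (n * x) / Real.sin x * Real.cos x + Real.cos (n * x) := by
      rw [Nat.cast_succ, add_one_mul, Real.sin_add]
      field_simp
    rw [cos_succ, sin_succ]
    exact ⟨K.sub_mem (K.mul_mem hc hcos) (K.mul_mem hs hsq), K.add_mem (K.mul_mem hs hcos) hc⟩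

theorem sin_int_mul_div_sin_mem {F : Type*} [Field F] [Algebra F ℝ]
    (K : IntermediateField F ℝ) {x : ℝ} (hsin : Real.sin x ≠ 0) (hcos : Real.cos x ∈ K) (m : ℤ) :
    Real.sin (m * x) / Real.sin x ∈ K := by
  obtain ⟨n, rfl | rfl⟩ := m.eq_nat_or_neg
  · exact_mod_cast (cos_nat_mul_mem_and_sin_nat_mul_div_sin_mem K hsin hcos n).2
  · simpa [neg_div] using (cos_nat_mul_mem_and_sin_nat_mul_div_sin_mem K hsin hcos n).2

theorem sin_pi_div_five_ne_zero : Real.sin (Real.pi / 5) ≠ 0 :=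
  (Real.sin_pos_of_pos_of_lt_pi (by positivity) (by linarith [Real.pi_pos])).ne'

theorem cos_pi_div_five_mem_adjoin_sqrt_five :
    Real.cos (Real.pi / 5) ∈ IntermediateField.adjoin ℚ {Real.sqrt 5} := by
  rw [Real.cos_pi_div_five]
  exact div_mem (add_mem (one_mem _) (IntermediateField.mem_adjoin_simple_self ℚ _))
    (ofNat_mem _ 4)

theorem sin_pi_mul_div_sin_pi_div_five_mem (r : ℚ) (h : r.den = 5) :
    Real.sin (Real.pi * (r : ℝ)) / Real.sin (Real.pi / 5) ∈
      IntermediateField.adjoin ℚ {Real.sqrt 5} := by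
  have hr : Real.pi * (r : ℝ) = r.num * (Real.pi / 5) := by
    rw [Rat.cast_def, h]
    push_cast
    ring
  rw [hr]
  exact sin_int_mul_div_sin_mem _ sin_pi_div_five_ne_zero cos_pi_div_five_mem_adjoin_sqrt_five _

theorem sin_ratio_den_five_mem_quadratic (r1 r2 : ℚ)
    (h1 : r1.den = 5) (h2 : r2.den = 5)
    (hsub : ¬ ∃ k : ℤ, r1 - r2 = (k : ℚ)) (hadd : ¬ ∃ k : ℤ, r1 + r2 = (k : ℚ)) :
    Real.sin (Real.pi * (r1 : ℝ)) / Real.sin (Real.pi * (r2 : ℝ)) ∈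
      IntermediateField.adjoin ℚ {Real.sqrt 5} ∧
    Real.sin (2 * Real.pi / 5) / Real.sin (Real.pi / 5) = (1 + Real.sqrt 5) / 2 := by
  have hne := sin_pi_div_five_ne_zero
  constructor
  · rw [← div_div_div_cancel_right₀ hne]
    exact div_mem (sin_pi_mul_div_sin_pi_div_five_mem r1 h1)
      (sin_pi_mul_div_sin_pi_div_five_mem r2 h2)
  · rw [mul_div_assoc, Real.sin_two_mul, Real.cos_pi_div_five]
    field_simp
    ring
end
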